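/- There exists H₀ ≥ 3 such that for every real number H ≥ H₀, the number of positive integers n ≤ H whose number of distinct prime divisors ω(n) lies outside the interval [log log H − (1/2)·(log log H)^{3/4}, log log H + (1/2)·(log log H)^{3/4}] is at most H · exp( −(1/10)·(log log H)^{1/2} ). -/

import Mathlib

theorem sum_Ioc_sum_divisorsAntidiagonal {M : Type*} [AddCommMonoid M] (N : ℕ) (F : ℕ → ℕ → M) :
    ∑ n ∈ Finset.Ioc 0 N, ∑ x ∈ n.divisorsAntidiagonal, F x.1 x.2 =
      ∑ a ∈ Finset.Ioc 0 N, ∑ b ∈ Finset.Ioc 0 (N / a), F a b := by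
  rw [Finset.sum_sigma', Finset.sum_sigma']
  refine Finset.sum_bij' (fun x _ ↦ ⟨x.2.1, x.2.2⟩) (fun x _ ↦ ⟨x.1 * x.2, (x.1, x.2)⟩) ?_ ?_ ?_ ?_ ?_
  · rintro ⟨n, a, b⟩ h
    simp only [Finset.mem_sigma, Finset.mem_Ioc, Nat.mem_divisorsAntidiagonal] at h ⊢
    obtain ⟨⟨h0, hN⟩, rfl, hne⟩ := h
    have ha : 0 < a := Nat.pos_of_ne_zero (left_ne_zero_of_mul hne)
    have hb : 0 < b := Nat.pos_of_ne_zero (right_ne_zero_of_mul hne)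
    refine ⟨⟨ha, (Nat.le_mul_of_pos_right a hb).trans hN⟩, hb, ?_⟩
    rwa [Nat.le_div_iff_mul_le ha, mul_comm]
  · rintro ⟨a, b⟩ h
    simp only [Finset.mem_sigma, Finset.mem_Ioc, Nat.mem_divisorsAntidiagonal] at h ⊢
    obtain ⟨⟨ha, haN⟩, hb, hbN⟩ := h
    rw [Nat.le_div_iff_mul_le ha, mul_comm] at hbN
    have := Nat.mul_pos ha hb
    exact ⟨⟨this, hbN⟩, trivial, this.ne'⟩
  · rintro ⟨n, a, b⟩ h
    simp only [Finset.mem_sigma, Finset.mem_Ioc, Nat.mem_divisorsAntidiagonal] at h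
    obtain ⟨_, rfl, _⟩ := h
    rfl
  · rintro ⟨a, b⟩ _
    rfl
  · rintro ⟨n, a, b⟩ _
    rfl

open ArithmeticFunction in
theorem sum_divisorsAntidiagonal_vonMangoldt_fst (n : ℕ) :
    ∑ x ∈ n.divisorsAntidiagonal, vonMangoldt x.1 = Real.log n := by
  rw [Nat.sum_divisorsAntidiagonal (fun a _ ↦ vonMangoldt a), vonMangoldt_sum]

open ArithmeticFunction in
theorem sum_divisorsAntidiagonal_vonMangoldt_snd (n : ℕ) :
    ∑ x ∈ n.divisorsAntidiagonal, vonMangoldt x.2 = Real.log n := by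
  rw [Nat.sum_divisorsAntidiagonal' (fun _ b ↦ vonMangoldt b), vonMangoldt_sum]

open ArithmeticFunction in
theorem sum_primesLE_log_div_le {N : ℕ} (hN : 0 < N) :
    ∑ p ∈ N.primesLE, Real.log p / p ≤ Real.log N + Real.log 4 := by
  have hN' : (0 : ℝ) < N := by exact_mod_cast hN
  have h1 : ∑ p ∈ N.primesLE, ((N / p : ℕ) : ℝ) * Real.log p ≤ N * Real.log N := by
    calc ∑ p ∈ N.primesLE, ((N / p : ℕ) : ℝ) * Real.log p
        = ∑ p ∈ N.primesLE, ((N / p : ℕ) : ℝ) * vonMangoldt p :=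
          Finset.sum_congr rfl fun p hp ↦ by
            rw [vonMangoldt_apply_prime (Nat.prime_of_mem_primesLE hp)]
      _ ≤ ∑ d ∈ Finset.Ioc 0 N, ((N / d : ℕ) : ℝ) * vonMangoldt d := by
          rw [Nat.primesLE_eq_filter_Ioc_zero]
          exact Finset.sum_le_sum_of_subset_of_nonneg (Finset.filter_subset _ _)
            fun _ _ _ ↦ mul_nonneg (Nat.cast_nonneg _) vonMangoldt_nonneg
      _ = ∑ n ∈ Finset.Ioc 0 N, Real.log n := by
          simp_rw [← sum_divisorsAntidiagonal_vonMangoldt_fst]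
          rw [sum_Ioc_sum_divisorsAntidiagonal N (fun a _ ↦ vonMangoldt a)]
          simp
      _ ≤ ∑ n ∈ Finset.Ioc 0 N, Real.log N := by
          refine Finset.sum_le_sum fun n hn ↦ ?_
          rw [Finset.mem_Ioc] at hn
          exact Real.log_le_log (by exact_mod_cast hn.1) (by exact_mod_cast hn.2)
      _ = N * Real.log N := by simp
  have h2 : ∑ p ∈ N.primesLE, Real.log p ≤ Real.log 4 * N := by
    rw [← Chebyshev.theta_eq_sum_primesLE_log]
    exact Chebyshev.theta_le_log4_mul_x hN'.le
  have h3 : N * ∑ p ∈ N.primesLE, Real.log p / p ≤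
      ∑ p ∈ N.primesLE, ((N / p : ℕ) : ℝ) * Real.log p + ∑ p ∈ N.primesLE, Real.log p := by
    rw [Finset.mul_sum, ← Finset.sum_add_distrib]
    refine Finset.sum_le_sum fun p hp ↦ ?_
    have hp0 : 0 < p := (Nat.prime_of_mem_primesLE hp).pos
    have h := (Nat.lt_div_mul_add (a := N) hp0).le
    have hp' : (0 : ℝ) < p := by exact_mod_cast hp0
    have h' : (N : ℝ) / p ≤ ((N / p : ℕ) : ℝ) + 1 := by
      rw [div_le_iff₀ hp']
      have : (N : ℝ) ≤ ((N / p : ℕ) : ℝ) * p + p := by exact_mod_cast h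
      linarith
    calc (N : ℝ) * (Real.log p / p) = N / p * Real.log p := by ring
      _ ≤ (((N / p : ℕ) : ℝ) + 1) * Real.log p := by gcongr
      _ = _ := by ring
  refine le_of_mul_le_mul_left (h3.trans ?_) hN'
  linarith

theorem sum_primesLE_succ (f : ℕ → ℝ) (N : ℕ) :
    ∑ p ∈ (N + 1).primesLE, f p =
      ∑ p ∈ N.primesLE, f p + if (N + 1).Prime then f (N + 1) else 0 := by
  simp only [Nat.primesLE_eq_filter_range, Finset.sum_filter]
  rw [Finset.sum_range_succ]

/-- The upper bound in Mertens' second theorem. -/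
theorem exists_sum_primesLE_inv_le :
    ∃ K : ℝ, 0 ≤ K ∧ ∀ N : ℕ, 2 ≤ N →
      ∑ p ∈ N.primesLE, (p : ℝ)⁻¹ ≤ Real.log (Real.log N) + K := by
  have key : ∀ N : ℕ, 2 ≤ N → ∑ p ∈ N.primesLE, (p : ℝ)⁻¹ -
      (∑ p ∈ N.primesLE, Real.log p / p) / Real.log N ≤
      Real.log (Real.log N) - Real.log 4 / Real.log N +
        (Real.log 4 / Real.log 2 - Real.log (Real.log 2)) := by
    intro N hN
    induction N, hN using Nat.le_induction with
    | base =>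
      have : Nat.primesLE 2 = {2} := by decide
      have h2 : Real.log 2 ≠ 0 := (Real.log_pos one_lt_two).ne'
      rw [this]
      simp only [Finset.sum_singleton, Nat.cast_ofNat]
      rw [div_div, mul_comm, ← div_div, div_self h2]
      norm_num
    | succ N hN ih =>
      have ha : 0 < Real.log N := Real.log_pos (by exact_mod_cast hN)
      have hab : Real.log N ≤ Real.log (N + 1 : ℕ) :=
        Real.log_le_log (by positivity) (by push_cast; linarith)
      have hb := ha.trans_le hab
      have hA := sum_primesLE_log_div_le (N := N) (by lia)
      rw [sum_primesLE_succ (fun p ↦ (p : ℝ)⁻¹), sum_primesLE_succ (fun p ↦ Real.log p / p)]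
      have e : (if (N + 1).Prime then Real.log (N + 1 : ℕ) / (N + 1 : ℕ) else 0) /
          Real.log (N + 1 : ℕ) = if (N + 1).Prime then ((N + 1 : ℕ) : ℝ)⁻¹ else 0 := by
        split_ifs
        · field_simp
        · simp
      rw [add_div, e]
      generalize Real.log N = a at *
      generalize Real.log (N + 1 : ℕ) = b at *
      generalize ∑ p ∈ N.primesLE, Real.log p / p = A at *
      have hlog : 1 - a / b ≤ Real.log b - Real.log a := by
        have := Real.one_sub_inv_le_log_of_pos (div_pos hb ha)
        rwa [inv_div, Real.log_div hb.ne' ha.ne'] at this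
      have hinv : 0 ≤ a⁻¹ - b⁻¹ := sub_nonneg.2 (inv_anti₀ ha hab)
      have hm := mul_le_mul_of_nonneg_right hA hinv
      have : (a + Real.log 4) * (a⁻¹ - b⁻¹) =
        1 - a / b + Real.log 4 / a - Real.log 4 / b := by field_simp; ring
      have : A * (a⁻¹ - b⁻¹) = A / a - A / b := by ring
      linarith
  refine ⟨1 + Real.log 4 / Real.log 2 - Real.log (Real.log 2), ?_, fun N hN ↦ ?_⟩
  · have h2 := Real.log_pos one_lt_two
    have : Real.log (Real.log 2) ≤ 0 :=
      Real.log_nonpos h2.le (Real.log_two_lt_d9.le.trans (by norm_num))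
    have : 0 ≤ Real.log 4 / Real.log 2 := div_nonneg (Real.log_nonneg (by norm_num)) h2.le
    linarith
  · have ha : 0 < Real.log N := Real.log_pos (by exact_mod_cast hN)
    have hA := sum_primesLE_log_div_le (N := N) (by lia)
    have hA' := div_le_div_of_nonneg_right hA ha.le
    rw [add_div, div_self ha.ne'] at hA'
    linarith [key N hN]

theorem sum_primesLE_inv_sub_one_le (N : ℕ) :
    ∑ p ∈ N.primesLE, ((p : ℝ) - 1)⁻¹ ≤ ∑ p ∈ N.primesLE, (p : ℝ)⁻¹ + 1 := by
  have key : ∀ N : ℕ, 1 ≤ N → ∑ n ∈ Finset.Ioc 1 N, (((n : ℝ) - 1)⁻¹ - (n : ℝ)⁻¹) =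
      1 - (N : ℝ)⁻¹ := by
    intro N hN
    induction N, hN using Nat.le_induction with
    | base => simp
    | succ N hN ih =>
      rw [Finset.sum_Ioc_succ_top (by lia), ih]
      push_cast
      ring
  have h : ∑ p ∈ N.primesLE, (((p : ℝ) - 1)⁻¹ - (p : ℝ)⁻¹) ≤ 1 := by
    rcases Nat.eq_zero_or_pos N with rfl | hN
    · simp [Nat.primesLE]
    calc _ ≤ ∑ n ∈ Finset.Ioc 1 N, (((n : ℝ) - 1)⁻¹ - (n : ℝ)⁻¹) := by
          rw [Nat.primesLE_eq_filter_Ioc_one]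
          refine Finset.sum_le_sum_of_subset_of_nonneg (Finset.filter_subset _ _) fun n hn _ ↦ ?_
          have : (1 : ℝ) < n := by exact_mod_cast (Finset.mem_Ioc.1 hn).1
          exact sub_nonneg.2 (inv_anti₀ (by linarith) (by linarith))
      _ ≤ 1 := by rw [key N hN]; simp
  rw [Finset.sum_sub_distrib] at h
  linarith

theorem hasSum_pow_card_primeFactors_prime_pow_div (z : ℝ) {p : ℕ} (hp : p.Prime) :
    HasSum (fun e : ℕ ↦ z ^ (p ^ e).primeFactors.card / ((p ^ e : ℕ) : ℝ))
      (1 + z * ((p : ℝ) - 1)⁻¹) := by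
  have hp1 : (1 : ℝ) < p := by exact_mod_cast hp.one_lt
  have h1 := (hasSum_geometric_of_lt_one (r := (p : ℝ)⁻¹) (by positivity)
    (inv_lt_one_of_one_lt₀ hp1)).mul_left z
  have h2 := h1.add (hasSum_ite_eq (0 : ℕ) (1 - z))
  have hval : z * (1 - (p : ℝ)⁻¹)⁻¹ + (1 - z) = 1 + z * ((p : ℝ) - 1)⁻¹ := by
    have : (p : ℝ) - 1 ≠ 0 := by linarith
    have : (p : ℝ) ≠ 0 := by linarith
    field_simp
    ring
  rw [hval] at h2
  refine h2.congr_fun fun e ↦ ?_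
  rcases Nat.eq_zero_or_pos e with rfl | he
  · simp
  · rw [Nat.primeFactors_prime_pow he.ne' hp]
    simp [he.ne', div_eq_mul_inv]

theorem sum_pow_card_primeFactors_div_le {z : ℝ} (hz : 0 ≤ z) (N : ℕ) :
    ∑ n ∈ Finset.Ioc 0 N, z ^ n.primeFactors.card / (n : ℝ) ≤
      Real.exp (z * (∑ p ∈ N.primesLE, (p : ℝ)⁻¹ + 1)) := by
  set g : ℕ → ℝ := fun n ↦ z ^ n.primeFactors.card / (n : ℝ) with hg
  have hg0 : ∀ n, 0 ≤ g n := fun n ↦ by positivity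
  have hg1 : g 1 = 1 := by simp [hg]
  have hmul : ∀ {m n : ℕ}, m.Coprime n → g (m * n) = g m * g n := by
    intro m n h
    simp only [hg, h.primeFactors_mul, Finset.card_union_of_disjoint h.disjoint_primeFactors]
    rw [Nat.cast_mul, pow_add, mul_div_mul_comm]
  have hsum : ∀ {p : ℕ}, p.Prime → Summable fun e : ℕ ↦ ‖g (p ^ e)‖ := fun hp ↦
    (hasSum_pow_card_primeFactors_prime_pow_div z hp).summable.norm
  obtain ⟨-, h⟩ := EulerProduct.summable_and_hasSum_smoothNumbers_prod_primesBelow_tsum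
    hg1 hmul hsum (N + 1)
  have hsub : ∀ n ∈ Finset.Ioc 0 N, n ∈ (N + 1).smoothNumbers := by
    intro n hn
    rw [Finset.mem_Ioc] at hn
    exact ⟨hn.1.ne', fun p hp ↦ Nat.lt_succ_of_le
      ((Nat.le_of_mem_primeFactorsList hp).trans hn.2)⟩
  classical
  calc ∑ n ∈ Finset.Ioc 0 N, g n
      = ∑ n ∈ (Finset.Ioc 0 N).subtype (· ∈ (N + 1).smoothNumbers), g n :=
        (Finset.sum_subtype_of_mem g hsub).symm
    _ ≤ ∏ p ∈ (N + 1).primesBelow, ∑' e : ℕ, g (p ^ e) :=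
        sum_le_hasSum _ (fun _ _ ↦ hg0 _) h
    _ ≤ ∏ p ∈ N.primesLE, Real.exp (z * ((p : ℝ) - 1)⁻¹) := by
        refine Finset.prod_le_prod (fun p _ ↦ tsum_nonneg fun _ ↦ hg0 _) fun p hp ↦ ?_
        rw [(hasSum_pow_card_primeFactors_prime_pow_div z
          (Nat.prime_of_mem_primesBelow hp)).tsum_eq, add_comm]
        exact Real.add_one_le_exp _
    _ = Real.exp (z * ∑ p ∈ N.primesLE, ((p : ℝ) - 1)⁻¹) := by
        rw [← Real.exp_sum, Finset.mul_sum]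
    _ ≤ _ := by
        gcongr
        exact sum_primesLE_inv_sub_one_le N

theorem card_primeFactors_mul_le_add_one {a b : ℕ} (hb : IsPrimePow b) :
    (a * b).primeFactors.card ≤ a.primeFactors.card + 1 := by
  obtain ⟨p, k, hp, hk, rfl⟩ := hb
  rcases eq_or_ne a 0 with rfl | ha
  · simp
  rw [Nat.primeFactors_mul ha (pow_ne_zero _ hp.ne_zero),
    Nat.primeFactors_prime_pow hk.ne' hp.nat_prime]
  exact (Finset.card_union_le _ _).trans (by simp)

theorem pow_card_primeFactors_mul_le {z : ℝ} (hz : 0 ≤ z) (hz2 : z ≤ 2) {a b : ℕ} (ha : a ≠ 0)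
    (hb : IsPrimePow b) :
    z ^ (a * b).primeFactors.card ≤ 2 * z ^ a.primeFactors.card := by
  have h0 : 0 ≤ z ^ a.primeFactors.card := pow_nonneg hz _
  have hle : a.primeFactors.card ≤ (a * b).primeFactors.card := by
    rw [Nat.primeFactors_mul ha hb.ne_zero]
    exact Finset.card_le_card Finset.subset_union_left
  rcases le_total z 1 with h1 | h1
  · linarith [pow_le_pow_of_le_one hz h1 hle]
  · calc z ^ (a * b).primeFactors.card ≤ z ^ (a.primeFactors.card + 1) :=
          pow_le_pow_right₀ h1 (card_primeFactors_mul_le_add_one hb)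
      _ = z * z ^ a.primeFactors.card := pow_succ' _ _
      _ ≤ _ := by gcongr

open ArithmeticFunction in
theorem sum_pow_card_primeFactors_mul_log_le {z : ℝ} (hz : 0 ≤ z) (hz2 : z ≤ 2) (N : ℕ) :
    ∑ n ∈ Finset.Ioc 0 N, z ^ n.primeFactors.card * Real.log n ≤
      2 * (Real.log 4 + 4) * N * ∑ n ∈ Finset.Ioc 0 N, z ^ n.primeFactors.card / (n : ℝ) := by
  calc ∑ n ∈ Finset.Ioc 0 N, z ^ n.primeFactors.card * Real.log n
      = ∑ n ∈ Finset.Ioc 0 N, ∑ x ∈ n.divisorsAntidiagonal,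
          z ^ (x.1 * x.2).primeFactors.card * vonMangoldt x.2 := by
        refine Finset.sum_congr rfl fun n _ ↦ ?_
        rw [← sum_divisorsAntidiagonal_vonMangoldt_snd, Finset.mul_sum]
        refine Finset.sum_congr rfl fun x hx ↦ ?_
        rw [(Nat.mem_divisorsAntidiagonal.1 hx).1]
    _ = ∑ a ∈ Finset.Ioc 0 N, ∑ b ∈ Finset.Ioc 0 (N / a),
          z ^ (a * b).primeFactors.card * vonMangoldt b :=
        sum_Ioc_sum_divisorsAntidiagonal N
          fun a b ↦ z ^ (a * b).primeFactors.card * vonMangoldt b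
    _ ≤ ∑ a ∈ Finset.Ioc 0 N, ∑ b ∈ Finset.Ioc 0 (N / a),
          2 * z ^ a.primeFactors.card * vonMangoldt b := by
        refine Finset.sum_le_sum fun a ha ↦ Finset.sum_le_sum fun b _ ↦ ?_
        by_cases hb : IsPrimePow b
        · exact mul_le_mul_of_nonneg_right (pow_card_primeFactors_mul_le hz hz2
            (Finset.mem_Ioc.1 ha).1.ne' hb) vonMangoldt_nonneg
        · simp [vonMangoldt_apply, hb]
    _ ≤ ∑ a ∈ Finset.Ioc 0 N,
          2 * z ^ a.primeFactors.card * ((Real.log 4 + 4) * (N / a)) := by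
        refine Finset.sum_le_sum fun a _ ↦ ?_
        rw [← Finset.mul_sum]
        gcongr
        have h := Chebyshev.psi_le_const_mul_self (x := (N : ℝ) / a) (by positivity)
        rwa [Chebyshev.psi, Nat.floor_div_eq_div] at h
    _ = _ := by
        rw [Finset.mul_sum]
        exact Finset.sum_congr rfl fun a _ ↦ by ring

/-- The moments of `z ^ ω(n)` are `O(H (log H) ^ (z - 1))`, uniformly for `0 ≤ z ≤ 2`. -/
theorem exists_sum_pow_card_primeFactors_le :
    ∃ C : ℝ, 0 < C ∧ ∀ H z : ℝ, 3 ≤ H → 0 ≤ z → z ≤ 2 →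
      ∑ n ∈ Finset.Ioc 0 ⌊H⌋₊, z ^ n.primeFactors.card ≤
        C * H * Real.exp ((z - 1) * Real.log (Real.log H)) := by
  obtain ⟨K, hK0, hK⟩ := exists_sum_primesLE_inv_le
  have h4 : 0 ≤ Real.log 4 := Real.log_nonneg (by norm_num)
  refine ⟨(2 * (Real.log 4 + 4) + 1) * Real.exp (2 * (K + 1)), by positivity,
    fun H z hH hz hz2 ↦ ?_⟩
  have hH0 : 0 < H := by linarith
  have hN3 : 3 ≤ ⌊H⌋₊ := Nat.le_floor (by exact_mod_cast hH)
  have hNH : (⌊H⌋₊ : ℝ) ≤ H := Nat.floor_le hH0.le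
  generalize ⌊H⌋₊ = N at *
  have hN : (3 : ℝ) ≤ N := by exact_mod_cast hN3
  have hlogN : 0 < Real.log N := Real.log_pos (by linarith)
  have hlogH : 0 < Real.log H := Real.log_pos (by linarith)
  set G := ∑ n ∈ Finset.Ioc 0 N, z ^ n.primeFactors.card / (n : ℝ) with hG
  have hG0 : 0 ≤ G := Finset.sum_nonneg fun _ _ ↦ by positivity
  have hG1 : G ≤ Real.exp (z * Real.log (Real.log H)) * Real.exp (2 * (K + 1)) := by
    rw [← Real.exp_add]
    refine (sum_pow_card_primeFactors_div_le hz N).trans (Real.exp_le_exp.2 ?_)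
    have h1 : ∑ p ∈ N.primesLE, (p : ℝ)⁻¹ ≤ Real.log (Real.log H) + K := by
      refine (hK N (by lia)).trans ?_
      gcongr
    have h2 : z * (∑ p ∈ N.primesLE, (p : ℝ)⁻¹ + 1) ≤ z * (Real.log (Real.log H) + K + 1) := by
      gcongr
    have h3 : z * (K + 1) ≤ 2 * (K + 1) := by gcongr
    linarith
  have hS : Real.log H * ∑ n ∈ Finset.Ioc 0 N, z ^ n.primeFactors.card ≤
      (2 * (Real.log 4 + 4) + 1) * H * G := by
    calc Real.log H * ∑ n ∈ Finset.Ioc 0 N, z ^ n.primeFactors.card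
        ≤ ∑ n ∈ Finset.Ioc 0 N, (z ^ n.primeFactors.card * Real.log n +
            H * (z ^ n.primeFactors.card / (n : ℝ))) := by
          rw [Finset.mul_sum]
          refine Finset.sum_le_sum fun n hn ↦ ?_
          have hn0 : (0 : ℝ) < n := by exact_mod_cast (Finset.mem_Ioc.1 hn).1
          have h := Real.log_le_self (div_pos hH0 hn0).le
          rw [Real.log_div hH0.ne' hn0.ne'] at h
          have h' := mul_le_mul_of_nonneg_left h (pow_nonneg hz n.primeFactors.card)
          calc _ = z ^ n.primeFactors.card * Real.log n +
                z ^ n.primeFactors.card * (Real.log H - Real.log n) := by ring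
            _ ≤ z ^ n.primeFactors.card * Real.log n + z ^ n.primeFactors.card * (H / n) := by
                gcongr
            _ = _ := by ring
      _ ≤ 2 * (Real.log 4 + 4) * H * G + H * G := by
          rw [Finset.sum_add_distrib, ← Finset.mul_sum]
          gcongr
          refine (sum_pow_card_primeFactors_mul_log_le hz hz2 N).trans ?_
          gcongr
      _ = _ := by ring
  have hexp : Real.exp ((z - 1) * Real.log (Real.log H)) =
      Real.exp (z * Real.log (Real.log H)) / Real.log H := by
    rw [sub_mul, one_mul, Real.exp_sub, Real.exp_log hlogH]
  rw [hexp, ← mul_div_assoc, le_div_iff₀' hlogH]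
  refine hS.trans ?_
  calc _ ≤ (2 * (Real.log 4 + 4) + 1) * H *
        (Real.exp (z * Real.log (Real.log H)) * Real.exp (2 * (K + 1))) := by gcongr
    _ = _ := by ring

theorem add_sq_le_one_add_mul_log {u : ℝ} (hu : |u| ≤ 1 / 40) :
    u + 9 / 20 * u ^ 2 ≤ (1 + u) * Real.log (1 + u) := by
  have h := Real.abs_log_sub_add_sum_range_le (x := -u) (by rw [abs_neg]; linarith) 2
  rw [abs_neg] at h
  have hb : |u| ^ (2 + 1) / (1 - |u|) ≤ u ^ 2 / 39 := by
    rw [← sq_abs u]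
    generalize |u| = v at hu
    rw [div_le_div_iff₀ (by linarith) (by norm_num)]
    change v ^ 3 * 39 ≤ v ^ 2 * (1 - v)
    linarith [mul_nonneg (sq_nonneg v) (sub_nonneg.2 hu)]
  have h1 := (abs_le.1 (h.trans hb)).1
  simp only [Finset.sum_range_succ, Finset.sum_range_zero, sub_neg_eq_add] at h1
  norm_num at h1
  obtain ⟨hl, hr⟩ := abs_le.1 hu
  have h2 : u - u ^ 2 / 2 - u ^ 2 / 39 ≤ Real.log (1 + u) := by linarith
  have h3 := mul_le_mul_of_nonneg_left h2 (by linarith : 0 ≤ 1 + u)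
  nlinarith [mul_nonneg (sq_nonneg u) (by linarith : 0 ≤ u + 1 / 40),
    mul_nonneg (sq_nonneg u) (by linarith : 0 ≤ 1 / 40 - u)]

/-- A Chernoff bound for the number of integers up to `H` whose number of distinct prime factors
is at least (if `u ≥ 0`) or at most (if `u ≤ 0`) `(1 + u) log log H`. -/
theorem exists_card_le_of_mul_log_nonneg :
    ∃ C : ℝ, 0 < C ∧ ∀ H u : ℝ, 3 ≤ H → |u| ≤ 1 / 40 → ∀ S ⊆ Finset.Ioc 0 ⌊H⌋₊,
      (∀ n ∈ S, 0 ≤ ((n.primeFactors.card : ℝ) - (1 + u) * Real.log (Real.log H)) *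
        Real.log (1 + u)) →
      (S.card : ℝ) ≤ C * H * Real.exp (-(9 / 20 * u ^ 2 * Real.log (Real.log H))) := by
  obtain ⟨C, hC, h⟩ := exists_sum_pow_card_primeFactors_le
  refine ⟨C, hC, fun H u hH hu S hS hSn ↦ ?_⟩
  obtain ⟨hl, hr⟩ := abs_le.1 hu
  have hz : 0 < 1 + u := by linarith
  have hL : 0 ≤ Real.log (Real.log H) := by
    refine Real.log_nonneg ?_
    rw [Real.le_log_iff_exp_le (by linarith)]
    linarith [Real.exp_one_lt_d9]
  have hm := h H (1 + u) hH hz.le (by linarith)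
  generalize Real.log (Real.log H) = L at *
  have h1 : S.card * Real.exp ((1 + u) * Real.log (1 + u) * L) ≤
      C * H * Real.exp (u * L) := by
    calc S.card * Real.exp ((1 + u) * Real.log (1 + u) * L)
        = ∑ n ∈ S, Real.exp ((1 + u) * Real.log (1 + u) * L) := by simp
      _ ≤ ∑ n ∈ S, (1 + u) ^ n.primeFactors.card := by
          refine Finset.sum_le_sum fun n hn ↦ ?_
          rw [← Real.exp_log (pow_pos hz _), Real.log_pow]
          exact Real.exp_le_exp.2 (by linarith [hSn n hn])
      _ ≤ ∑ n ∈ Finset.Ioc 0 ⌊H⌋₊, (1 + u) ^ n.primeFactors.card :=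
          Finset.sum_le_sum_of_subset_of_nonneg hS fun _ _ _ ↦ by positivity
      _ ≤ _ := by simpa using hm
  have h2 : Real.exp ((u + 9 / 20 * u ^ 2) * L) ≤
      Real.exp ((1 + u) * Real.log (1 + u) * L) := by
    gcongr
    exact add_sq_le_one_add_mul_log hu
  have h3 : S.card * Real.exp ((u + 9 / 20 * u ^ 2) * L) ≤ C * H * Real.exp (u * L) :=
    (by gcongr : _ ≤ _).trans h1
  rw [← le_div_iff₀ (Real.exp_pos _), mul_div_assoc, ← Real.exp_sub] at h3
  convert! h3 using 3
  ring

/-- For all sufficiently large `H`, the number of positive integers `n ≤ H` whose number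
of distinct prime factors `ω(n)` lies outside
`[log log H - (1/2)(log log H)^{3/4}, log log H + (1/2)(log log H)^{3/4}]`
is at most `H · exp(-(1/10)·(log log H)^{1/2})`. -/
theorem count_abnormal_omega :
    ∃ H₀ : ℝ, 3 ≤ H₀ ∧ ∀ H : ℝ, H₀ ≤ H →
      (Nat.card {n : ℕ // 1 ≤ n ∧ (n : ℝ) ≤ H ∧
        ¬ (Real.log (Real.log H) - (1/2) * Real.log (Real.log H) ^ ((3 : ℝ)/4)
              ≤ (n.primeFactors.card : ℝ) ∧
           (n.primeFactors.card : ℝ)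
              ≤ Real.log (Real.log H) + (1/2) * Real.log (Real.log H) ^ ((3 : ℝ)/4))} : ℝ)
        ≤ H * Real.exp (-(1/10) * Real.log (Real.log H) ^ ((1 : ℝ)/2)) := by
  obtain ⟨C, hC, h⟩ := exists_card_le_of_mul_log_nonneg
  obtain ⟨H₁, hH₁⟩ := Filter.eventually_atTop.1
    ((Real.tendsto_log_atTop.comp Real.tendsto_log_atTop).eventually_ge_atTop
      ((20 + 80 * |Real.log (2 * C)|) ^ 4))
  refine ⟨max 3 H₁, le_max_left _ _, fun H hH ↦ ?_⟩
  have hH3 : 3 ≤ H := (le_max_left _ _).trans hH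
  have hL := hH₁ H ((le_max_right _ _).trans hH)
  have hcard := fun u ↦ h H u hH3
  simp only [Function.comp_apply] at hL
  generalize Real.log (Real.log H) = L at *
  have hL0 : 0 < L := lt_of_lt_of_le (by positivity) hL
  obtain ⟨s, hs0, rfl⟩ : ∃ s : ℝ, 0 < s ∧ s ^ 4 = L :=
    ⟨L ^ (1 / 4 : ℝ), by positivity, by
      rw [← Real.rpow_natCast, ← Real.rpow_mul hL0.le]; norm_num⟩
  have hs : 20 + 80 * |Real.log (2 * C)| ≤ s := le_of_pow_le_pow_left₀ (by norm_num) hs0.le hL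
  have hs20 : 20 ≤ s := by linarith [abs_nonneg (Real.log (2 * C))]
  have e1 : (s ^ 4) ^ ((3 : ℝ) / 4) = s ^ 3 := by
    rw [← Real.rpow_natCast, ← Real.rpow_natCast, ← Real.rpow_mul hs0.le]; norm_num
  have e2 : (s ^ 4) ^ ((1 : ℝ) / 2) = s ^ 2 := by
    rw [← Real.rpow_natCast, ← Real.rpow_natCast, ← Real.rpow_mul hs0.le]; norm_num
  rw [e1, e2]
  set u : ℝ := 1 / (2 * s) with hu
  have hu0 : 0 < u := by positivity
  have hu40 : u ≤ 1 / 40 := by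
    rw [hu]; gcongr; linarith
  have hus : u * s ^ 4 = 1 / 2 * s ^ 3 := by rw [hu]; field_simp
  have hus2 : 9 / 20 * u ^ 2 * s ^ 4 = 9 / 80 * s ^ 2 := by rw [hu]; field_simp; norm_num
  set A := (Finset.Ioc 0 ⌊H⌋₊).filter
    fun n ↦ s ^ 4 + 1 / 2 * s ^ 3 < (n.primeFactors.card : ℝ) with hA
  set B := (Finset.Ioc 0 ⌊H⌋₊).filter
    fun n ↦ (n.primeFactors.card : ℝ) < s ^ 4 - 1 / 2 * s ^ 3 with hB
  have hcA := hcard u (by rwa [abs_of_pos hu0]) A (Finset.filter_subset _ _) fun n hn ↦ by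
    have := (Finset.mem_filter.1 hn).2
    exact mul_nonneg (by linarith) (Real.log_nonneg (by linarith))
  have hcB := hcard (-u) (by rwa [abs_neg, abs_of_pos hu0]) B (Finset.filter_subset _ _)
    fun n hn ↦ by
      have := (Finset.mem_filter.1 hn).2
      exact mul_nonneg_of_nonpos_of_nonpos (by linarith)
        (Real.log_nonpos (by linarith) (by linarith))
  rw [neg_sq, hus2] at hcB
  rw [hus2] at hcA
  have hle : Nat.card {n : ℕ // 1 ≤ n ∧ (n : ℝ) ≤ H ∧
      ¬ (s ^ 4 - (1/2) * s ^ 3 ≤ (n.primeFactors.card : ℝ) ∧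
        (n.primeFactors.card : ℝ) ≤ s ^ 4 + (1/2) * s ^ 3)} ≤ A.card + B.card := by
    refine le_trans ?_ (Finset.card_union_le A B)
    rw [← Set.ncard_coe_finset]
    refine Set.ncard_le_ncard (fun n hn ↦ ?_) (Finset.finite_toSet _)
    obtain ⟨h1, h2, h3⟩ := hn
    have hmem : n ∈ Finset.Ioc 0 ⌊H⌋₊ := Finset.mem_Ioc.2 ⟨h1, Nat.le_floor h2⟩
    rw [not_and_or, not_le, not_le] at h3
    simp only [hA, hB, Finset.coe_union, Set.mem_union, Finset.mem_coe, Finset.mem_filter]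
    exact h3.symm.imp (⟨hmem, ·⟩) (⟨hmem, ·⟩)
  have hlog : Real.log (2 * C) ≤ s ^ 2 / 80 := by
    have := le_abs_self (Real.log (2 * C))
    nlinarith
  calc _ ≤ (A.card : ℝ) + B.card := by exact_mod_cast hle
    _ ≤ H * (2 * C * Real.exp (-(9 / 80 * s ^ 2))) := by linarith
    _ ≤ H * Real.exp (-(1 / 10) * s ^ 2) := by
        gcongr
        rw [← Real.exp_log (by positivity : 0 < 2 * C), ← Real.exp_add]
        exact Real.exp_le_exp.2 (by linarith)
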